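/- Let n be a positive integer and let α < p_S(n) be a real number. There is a constant C = C(n, α) > 0 such that for every x₀ ∈ ℝⁿ, every R > 0, and every positive solution u of the Lane–Emden equation Δu + u^α = 0 on B(x₀, 2R), one has sup_{B(x₀,R)} ( |∇u|²/u² + u^{α−1} ) ≤ C / R². -/

import Mathlib

open Set Metric

/-- Euclidean space ℝⁿ. -/
abbrev E (n : ℕ) := EuclideanSpace ℝ (Fin n)

/-- The Laplacian of `u : ℝⁿ → ℝ`: the sum of its second partial derivatives. -/
noncomputable def lap {n : ℕ} (u : E n → ℝ) (x : E n) : ℝ :=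
  ∑ i : Fin n,
    iteratedFDeriv ℝ 2 u x ![EuclideanSpace.single i 1, EuclideanSpace.single i 1]

open scoped ContDiff Convolution Topology
open Filter MeasureTheory ContinuousLinearMap

/-- The partial derivative of `f` in the `i`-th coordinate direction. -/
noncomputable def pd {n : ℕ} (i : Fin n) (f : E n → ℝ) (x : E n) : ℝ :=
  fderiv ℝ f x (EuclideanSpace.single i 1)

section PartialDerivatives

theorem ContDiff.pd {n : ℕ} {f : E n → ℝ} {m k : WithTop ℕ∞} (hf : ContDiff ℝ k f)
    (hm : m + 1 ≤ k) (i : Fin n) : ContDiff ℝ m (pd i f) :=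
  (hf.fderiv_right hm).clm_apply contDiff_const

theorem HasCompactSupport.pd {n : ℕ} {f : E n → ℝ} (hf : HasCompactSupport f) (i : Fin n) :
    HasCompactSupport (pd i f) :=
  hf.fderiv_apply ℝ _

theorem pd_congr {n : ℕ} {f g : E n → ℝ} {x : E n} (h : f =ᶠ[𝓝 x] g) (i : Fin n) :
    pd i f x = pd i g x := by
  simp [pd, h.fderiv_eq]

theorem pd_const {n : ℕ} (c : ℝ) (i : Fin n) (x : E n) : pd i (fun _ => c) x = 0 := by
  simp [pd]

theorem pd_add {n : ℕ} {f g : E n → ℝ} {x : E n} (hf : DifferentiableAt ℝ f x)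
    (hg : DifferentiableAt ℝ g x) (i : Fin n) :
    pd i (fun y => f y + g y) x = pd i f x + pd i g x := by
  simp [pd, fderiv_fun_add hf hg]

theorem pd_neg {n : ℕ} {f : E n → ℝ} {x : E n} (i : Fin n) :
    pd i (fun y => -f y) x = -pd i f x := by
  simp [pd]

theorem pd_mul {n : ℕ} {f g : E n → ℝ} {x : E n} (hf : DifferentiableAt ℝ f x)
    (hg : DifferentiableAt ℝ g x) (i : Fin n) :
    pd i (fun y => f y * g y) x = pd i f x * g x + f x * pd i g x := by
  simp [pd, fderiv_fun_mul hf hg]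
  ring

theorem pd_sum {n : ℕ} {ι : Type*} (s : Finset ι) {f : ι → E n → ℝ} {x : E n}
    (hf : ∀ l ∈ s, DifferentiableAt ℝ (f l) x) (i : Fin n) :
    pd i (fun y => ∑ l ∈ s, f l y) x = ∑ l ∈ s, pd i (f l) x := by
  simp [pd, fderiv_fun_sum hf]

theorem pd_comp {n : ℕ} {f : E n → ℝ} {x : E n} {φ : ℝ → ℝ} {φ' : ℝ}
    (hφ : HasDerivAt φ φ' (f x)) (hf : DifferentiableAt ℝ f x) (i : Fin n) :
    pd i (fun y => φ (f y)) x = φ' * pd i f x := by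
  have h := hφ.comp_hasFDerivAt x hf.hasFDerivAt
  have h2 : fderiv ℝ (fun y => φ (f y)) x = φ' • fderiv ℝ f x := h.fderiv
  simp [pd, h2]

theorem pd_pd_apply {n : ℕ} {f : E n → ℝ} {x : E n} (hf : ContDiffAt ℝ 2 f x) (i j : Fin n) :
    pd i (pd j f) x =
      fderiv ℝ (fderiv ℝ f) x (EuclideanSpace.single i 1) (EuclideanSpace.single j 1) := by
  have h1 : DifferentiableAt ℝ (fderiv ℝ f) x :=
    (hf.fderiv_right (m := 1) (by norm_num)).differentiableAt (by norm_num)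
  have h2 : HasFDerivAt (fun y => fderiv ℝ f y (EuclideanSpace.single j (1 : ℝ)))
      ((fderiv ℝ (fderiv ℝ f) x).flip (EuclideanSpace.single j 1)) x := by
    simpa using h1.hasFDerivAt.clm_apply (hasFDerivAt_const (EuclideanSpace.single j (1 : ℝ)) x)
  exact congrArg (fun L => L (EuclideanSpace.single i 1)) h2.fderiv

theorem pd_comm {n : ℕ} {f : E n → ℝ} (hf : ContDiff ℝ 2 f) (i j : Fin n) (x : E n) :
    pd i (pd j f) x = pd j (pd i f) x := by
  rw [pd_pd_apply hf.contDiffAt, pd_pd_apply hf.contDiffAt]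
  exact (hf.contDiffAt.isSymmSndFDerivAt (by simp)).eq _ _

theorem lap_eq_sum_pd {n : ℕ} {f : E n → ℝ} {x : E n} (hf : ContDiffAt ℝ 2 f x) :
    lap f x = ∑ i, pd i (pd i f) x := by
  refine Finset.sum_congr rfl fun i _ => ?_
  rw [iteratedFDeriv_two_apply, pd_pd_apply hf]
  rfl

theorem norm_gradient_sq {n : ℕ} (f : E n → ℝ) (x : E n) :
    ‖gradient f x‖ ^ 2 = ∑ i, pd i f x ^ 2 := by
  rw [EuclideanSpace.norm_sq_eq]
  refine Finset.sum_congr rfl fun i _ => ?_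
  have h : pd i f x = inner ℝ (gradient f x) (EuclideanSpace.single i 1) := by
    rw [gradient, InnerProductSpace.toDual_symm_apply]
    rfl
  rw [h, EuclideanSpace.inner_single_right]
  simp

theorem pd_eq_zero_of_isLocalMax {n : ℕ} {f : E n → ℝ} {x : E n} (h : IsLocalMax f x)
    (i : Fin n) : pd i f x = 0 := by
  simp [pd, h.fderiv_eq_zero]

theorem hasDerivAt_comp_line {n : ℕ} {f : E n → ℝ} (hf : Differentiable ℝ f) (x : E n)
    (i : Fin n) (t : ℝ) :
    HasDerivAt (fun t : ℝ => f (x + t • EuclideanSpace.single i (1 : ℝ)))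
      (pd i f (x + t • EuclideanSpace.single i (1 : ℝ))) t := by
  have h1 : HasDerivAt (fun t : ℝ => x + t • EuclideanSpace.single i (1 : ℝ))
      (EuclideanSpace.single i (1 : ℝ)) t := by
    simpa using ((hasDerivAt_id t).smul_const (EuclideanSpace.single i (1 : ℝ))).const_add x
  exact (hf _).hasFDerivAt.comp_hasDerivAt t h1

theorem pd_pd_nonpos_of_isLocalMax {n : ℕ} {f : E n → ℝ} (hf : ContDiff ℝ 2 f) {x : E n}
    (h : IsLocalMax f x) (i : Fin n) : pd i (pd i f) x ≤ 0 := by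
  by_contra! hpos
  set γ : ℝ → E n := fun t => x + t • EuclideanSpace.single i (1 : ℝ) with hγ
  have hγ0 : γ 0 = x := by simp [hγ]
  have hd1 : deriv (fun t => f (γ t)) = fun t => pd i f (γ t) := by
    funext t
    exact (hasDerivAt_comp_line (hf.differentiable (by norm_num)) x i t).deriv
  have hd2 : deriv (deriv (fun t => f (γ t))) 0 = pd i (pd i f) x := by
    rw [hd1, ← hγ0]
    exact (hasDerivAt_comp_line ((hf.pd (m := 1) (by norm_num) i).differentiable
      (by norm_num)) x i 0).deriv
  have hγc : ContinuousAt γ 0 := by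
    simp only [hγ]; fun_prop
  have hmax : IsLocalMax (fun t => f (γ t)) 0 := by
    have : Tendsto γ (𝓝 0) (𝓝 x) := by simpa [ContinuousAt, hγ0] using hγc
    have h2 := this.eventually h
    simpa [IsLocalMax, IsMaxFilter, hγ0] using h2
  have hmin : IsLocalMin (fun t => f (γ t)) 0 := by
    refine isLocalMin_of_deriv_deriv_pos (by rw [hd2]; exact hpos) hmax.deriv_eq_zero ?_
    exact (hf.continuous.continuousAt).comp hγc
  have hconst : (fun t => f (γ t)) =ᶠ[𝓝 0] fun _ => f (γ 0) := by
    filter_upwards [hmax, hmin] with t h1 h2 using le_antisymm h1 h2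
  have : deriv (deriv (fun t => f (γ t))) 0 = 0 := by
    rw [hconst.deriv.deriv_eq]
    simp
  linarith [hd2 ▸ this]

end PartialDerivatives

section Mollification

variable {n : ℕ}

theorem pd_convolution (φ : ContDiffBump (0 : E n)) {f : E n → ℝ} (hf : ContDiff ℝ 1 f)
    (hc : HasCompactSupport f) (i : Fin n) :
    pd i (φ.normed volume ⋆[lsmul ℝ ℝ, volume] f) =
      (φ.normed volume ⋆[lsmul ℝ ℝ, volume] pd i f) := by
  funext x
  have hφ : LocallyIntegrable (φ.normed volume) (volume : Measure (E n)) :=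
    φ.continuous_normed.locallyIntegrable
  rw [pd, (hc.hasFDerivAt_convolution_right (lsmul ℝ ℝ) hφ hf x).fderiv,
    convolution_precompR_apply _ hφ (hc.fderiv ℝ) (hf.continuous_fderiv (by norm_num))]
  rfl

theorem contDiff_mollify (φ : ContDiffBump (0 : E n)) {f : E n → ℝ} (hf : Continuous f) :
    ContDiff ℝ ∞ (φ.normed volume ⋆[lsmul ℝ ℝ, volume] f) :=
  φ.hasCompactSupport_normed.contDiff_convolution_left _ φ.contDiff_normed hf.locallyIntegrable

theorem convolution_congr_ball (φ : ContDiffBump (0 : E n)) {f g : E n → ℝ} {x : E n}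
    (h : ∀ y ∈ ball x φ.rOut, f y = g y) :
    (φ.normed volume ⋆[lsmul ℝ ℝ, volume] f) x = (φ.normed volume ⋆[lsmul ℝ ℝ, volume] g) x := by
  simp only [convolution_def]
  refine integral_congr_ae (Eventually.of_forall fun t => ?_)
  by_cases ht : t ∈ ball (0 : E n) φ.rOut
  · have : x - t ∈ ball x φ.rOut := by simpa [dist_eq_norm] using ht
    simp [h _ this]
  · have : φ.normed volume t = 0 := by
      rw [← φ.support_normed_eq (μ := volume)] at ht
      simpa using ht
    simp [this]

theorem tendsto_mollify {φ : ℕ → ContDiffBump (0 : E n)}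
    (hφ : Tendsto (fun j => (φ j).rOut) atTop (𝓝 0)) {f : E n → ℝ} (hf : Continuous f)
    {z : ℕ → E n} {x : E n} (hz : Tendsto z atTop (𝓝 x)) :
    Tendsto (fun j => ((φ j).normed volume ⋆[lsmul ℝ ℝ, volume] f) (z j)) atTop (𝓝 (f x)) :=
  ContDiffBump.convolution_tendsto_right (g := fun _ => f) hφ
    (Eventually.of_forall fun _ => hf.aestronglyMeasurable)
    ((hf.tendsto x).comp tendsto_snd) hz

end Mollification

section Bernstein

variable {n : ℕ}

theorem pd_of_mul_isLocalMax {f g : E n → ℝ} (hf : ContDiff ℝ 2 f) (hg : ContDiff ℝ 2 g)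
    {x : E n} (hmax : IsLocalMax (fun y => f y * g y) x) (hfx : 0 < f x) {i : Fin n} {τ θ : ℝ}
    (hτ : pd i f x = f x * τ) (hθ : pd i (pd i f) x = f x * θ) :
    pd i g x = -(g x * τ) ∧ pd i (pd i g) x + g x * (θ - 2 * τ ^ 2) ≤ 0 := by
  have df : Differentiable ℝ f := hf.differentiable (by norm_num)
  have dg : Differentiable ℝ g := hg.differentiable (by norm_num)
  have df1 : Differentiable ℝ (pd i f) := (hf.pd (m := 1) (by norm_num) i).differentiable (by norm_num)
  have dg1 : Differentiable ℝ (pd i g) := (hg.pd (m := 1) (by norm_num) i).differentiable (by norm_num)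
  have h1 : pd i (fun y => f y * g y) = fun y => pd i f y * g y + f y * pd i g y :=
    funext fun y => pd_mul (df y) (dg y) i
  have e1 := pd_eq_zero_of_isLocalMax hmax i
  have e2 := pd_pd_nonpos_of_isLocalMax (hf.mul hg) hmax i
  rw [h1] at e1 e2
  rw [pd_add ((df1 x).fun_mul (dg x)) ((df x).fun_mul (dg1 x)), pd_mul (df1 x) (dg x),
    pd_mul (df x) (dg1 x)] at e2
  simp only [hτ, hθ] at e1 e2
  have e3 : pd i g x = -(g x * τ) := by
    have : f x * (pd i g x + g x * τ) = 0 := by linarith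
    rcases mul_eq_zero.1 this with h | h
    · exact absurd h hfx.ne'
    · linarith
  refine ⟨e3, ?_⟩
  rw [e3] at e2
  have : f x * (pd i (pd i g) x + g x * (θ - 2 * τ ^ 2)) ≤ 0 := by linarith
  by_contra! h
  linarith [mul_pos hfx h]

/-- The quantity `|∇v|² + d e^{kv}`. -/
noncomputable def energy (k d : ℝ) (v : E n → ℝ) (x : E n) : ℝ :=
  ∑ l, pd l v x ^ 2 + d * Real.exp (k * v x)

/-- The sum of the pure second partial derivatives. -/
noncomputable def sumPd (v : E n → ℝ) (x : E n) : ℝ := ∑ l, pd l (pd l v) x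

theorem contDiff_energy {k d : ℝ} {v : E n → ℝ} {m r : WithTop ℕ∞} (hv : ContDiff ℝ r v)
    (hm : m + 1 ≤ r) : ContDiff ℝ m (energy k d v) := by
  have h0 : ContDiff ℝ m v := hv.of_le (le_trans le_self_add hm)
  exact (ContDiff.sum fun l _ => (hv.pd hm l).pow 2).add
    (contDiff_const.mul (Real.contDiff_exp.comp (contDiff_const.mul h0)))

theorem pd_exp_mul {k : ℝ} {v : E n → ℝ} {x : E n} (hv : DifferentiableAt ℝ v x) (i : Fin n) :
    pd i (fun y => Real.exp (k * v y)) x = k * Real.exp (k * v x) * pd i v x := by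
  refine pd_comp (φ := fun t => Real.exp (k * t)) ?_ hv i
  have := ((hasDerivAt_id (v x)).const_mul k).exp
  simpa [mul_comm] using this

theorem pd_energy {k d : ℝ} {v : E n → ℝ} (hv : ContDiff ℝ 2 v) (i : Fin n) (x : E n) :
    pd i (energy k d v) x =
      ∑ l, 2 * pd l v x * pd i (pd l v) x + d * (k * Real.exp (k * v x) * pd i v x) := by
  have dv : Differentiable ℝ v := hv.differentiable (by norm_num)
  have dv1 (l) : Differentiable ℝ (pd l v) :=
    (hv.pd (m := 1) (by norm_num) l).differentiable (by norm_num)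
  have de : Differentiable ℝ fun y => Real.exp (k * v y) := (dv.const_mul k).exp
  have h : energy k d v = fun y => ∑ l, pd l v y * pd l v y + d * Real.exp (k * v y) := by
    funext y; simp [energy, sq]
  rw [h, pd_add (DifferentiableAt.fun_sum fun l _ => (dv1 l x).fun_mul (dv1 l x))
    ((de x).const_mul d), pd_sum _ fun l _ => (dv1 l x).fun_mul (dv1 l x),
    pd_mul (differentiableAt_const d) (de x), pd_const, pd_exp_mul (dv x)]
  congr 1
  · refine Finset.sum_congr rfl fun l _ => ?_
    rw [pd_mul (dv1 l x) (dv1 l x)]; ring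
  · ring

theorem sum_pd_pd_energy {k d : ℝ} {v : E n → ℝ} (hv : ContDiff ℝ ∞ v) (x : E n) :
    ∑ i, pd i (pd i (energy k d v)) x =
      2 * ∑ i, ∑ l, pd i (pd l v) x ^ 2 + 2 * ∑ l, pd l v x * pd l (sumPd v) x +
        d * (k * Real.exp (k * v x)) * (k * ∑ i, pd i v x ^ 2 + sumPd v x) := by
  have hv2 : ContDiff ℝ 2 v := by exact_mod_cast contDiff_infty.1 hv 2
  have c1 (l) : ContDiff ℝ ∞ (pd l v) := hv.pd (by simp) l
  have c2 (i l) : ContDiff ℝ ∞ (pd i (pd l v)) := (c1 l).pd (by simp) i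
  have dv : Differentiable ℝ v := hv.differentiable (by simp)
  have dv1 (l) : Differentiable ℝ (pd l v) := (c1 l).differentiable (by simp)
  have dv2 (i l) : Differentiable ℝ (pd i (pd l v)) := (c2 i l).differentiable (by simp)
  have de : Differentiable ℝ fun y => Real.exp (k * v y) := (dv.const_mul k).exp
  have key (i) : pd i (pd i (energy k d v)) x =
      ∑ l, (2 * pd i (pd l v) x ^ 2 + 2 * (pd l v x * pd l (pd i (pd i v)) x)) +
        d * (k * Real.exp (k * v x)) * (k * pd i v x ^ 2 + pd i (pd i v) x) := by
    have h : pd i (energy k d v) = fun y =>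
        ∑ l, 2 * (pd l v y * pd i (pd l v) y) + d * k * (Real.exp (k * v y) * pd i v y) := by
      funext y
      rw [pd_energy hv2]
      congr 1
      · exact Finset.sum_congr rfl fun l _ => by ring
      · ring
    have d3 (l) : DifferentiableAt ℝ (fun y => pd l v y * pd i (pd l v) y) x :=
      (dv1 l x).fun_mul (dv2 i l x)
    rw [h, pd_add (DifferentiableAt.fun_sum fun l _ => (d3 l).const_mul 2)
      (((de x).fun_mul (dv1 i x)).const_mul (d * k)), pd_sum _ fun l _ => (d3 l).const_mul 2,
      pd_mul (differentiableAt_const (d * k)) ((de x).fun_mul (dv1 i x)), pd_const,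
      pd_mul (de x) (dv1 i x), pd_exp_mul (dv x)]
    congr 1
    · refine Finset.sum_congr rfl fun l _ => ?_
      have e : pd i (pd i (pd l v)) x = pd l (pd i (pd i v)) x := by
        have : pd i (pd l v) = pd l (pd i v) := funext fun y => pd_comm hv2 i l y
        rw [this, pd_comm (by exact_mod_cast contDiff_infty.1 (c1 i) 2) i l]
      rw [pd_mul (differentiableAt_const 2) (d3 l), pd_const, pd_mul (dv1 l x) (dv2 i l x), e]
      ring
    · ring
  have hT (l) : pd l (sumPd v) x = ∑ i, pd l (pd i (pd i v)) x :=
    pd_sum (f := fun i => pd i (pd i v)) _ (fun i _ => dv2 i i x) l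
  simp only [key, hT, Finset.sum_add_distrib, ← Finset.mul_sum]
  rw [Finset.sum_comm (f := fun i l => pd l v x * pd l (pd i (pd i v)) x)]
  simp only [Finset.mul_sum, sumPd]

theorem pd_weight {s v : E n → ℝ} (hs : ContDiff ℝ 2 s) (hv : ContDiff ℝ 2 v) {β ε : ℝ}
    (hε : 0 < ε) {x : E n} (hsx : s x ≠ 0) (i : Fin n) {y τ : ℝ}
    (hy : y = Real.exp (v x) / (Real.exp (v x) + ε))
    (hτ : τ = 2 * (pd i s x / s x) - β * y * pd i v x) :
    pd i (fun z => s z ^ 2 * Real.exp (-β * Real.log (Real.exp (v z) + ε))) x =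
        s x ^ 2 * Real.exp (-β * Real.log (Real.exp (v x) + ε)) * τ ∧
      pd i (pd i fun z => s z ^ 2 * Real.exp (-β * Real.log (Real.exp (v z) + ε))) x =
        s x ^ 2 * Real.exp (-β * Real.log (Real.exp (v x) + ε)) *
          (τ ^ 2 - 2 * (pd i s x / s x) ^ 2 + 2 * (pd i (pd i s) x / s x)
            - β * (y * (1 - y)) * pd i v x ^ 2 - β * y * pd i (pd i v) x) := by
  have ds : Differentiable ℝ s := hs.differentiable (by norm_num)
  have dv : Differentiable ℝ v := hv.differentiable (by norm_num)
  have ds1 : Differentiable ℝ (pd i s) := (hs.pd (m := 1) (by norm_num) i).differentiable (by norm_num)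
  have dv1 : Differentiable ℝ (pd i v) := (hv.pd (m := 1) (by norm_num) i).differentiable (by norm_num)
  have hpos (z) : 0 < Real.exp (v z) + ε := by positivity
  set Y : E n → ℝ := fun z => Real.exp (v z) / (Real.exp (v z) + ε) with hY
  have dE : Differentiable ℝ fun z => Real.exp (v z) + ε := dv.exp.add_const ε
  have dY : Differentiable ℝ Y := by
    simp only [hY, div_eq_mul_inv]
    exact dv.exp.fun_mul (dE.fun_inv fun z => (hpos z).ne')
  set X : E n → ℝ := fun z => Real.exp (-β * Real.log (Real.exp (v z) + ε)) with hX
  have dX : Differentiable ℝ X := fun z =>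
    ((((dv z).exp.add_const ε).log (hpos z).ne').const_mul (-β)).exp
  have hXi (z) : pd i X z = -β * (Y z * (pd i v z * X z)) := by
    refine (pd_comp (φ := fun t => Real.exp (-β * Real.log (Real.exp t + ε)))
      (φ' := -β * (Y z * X z)) ?_ (dv z) i).trans (by ring)
    have := (((((Real.hasDerivAt_exp (v z)).add_const ε).log (hpos z).ne').const_mul (-β)).exp)
    refine this.congr_deriv ?_
    simp only [hX, hY]; ring
  have hYi : pd i Y x = Y x * (1 - Y x) * pd i v x := by
    refine pd_comp (φ := fun t => Real.exp t / (Real.exp t + ε)) ?_ (dv x) i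
    refine ((Real.hasDerivAt_exp (v x)).div ((Real.hasDerivAt_exp (v x)).add_const ε)
      (hpos x).ne').congr_deriv ?_
    have := (hpos x).ne'
    simp only [hY]; field_simp
  have hXi' : pd i X = fun z => -β * (Y z * (pd i v z * X z)) := funext hXi
  have h1 : pd i (fun z => s z ^ 2 * X z) = fun z =>
      2 * (s z * pd i s z) * X z + s z * (s z * pd i X z) := by
    funext z
    have : (fun z => s z ^ 2 * X z) = fun z => s z * (s z * X z) := by funext z; ring
    rw [this, pd_mul (ds z) ((ds z).fun_mul (dX z)), pd_mul (ds z) (dX z)]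
    ring
  have dX1 : Differentiable ℝ (pd i X) := by
    rw [hXi']
    exact (dY.mul (dv1.mul dX)).const_mul (-β)
  have hXii : pd i (pd i X) x = -β * (Y x * (1 - Y x) * pd i v x * (pd i v x * X x) +
      Y x * (pd i (pd i v) x * X x + pd i v x * pd i X x)) := by
    rw [hXi', pd_mul (differentiableAt_const _) ((dY x).fun_mul ((dv1 x).fun_mul (dX x))), pd_const,
      pd_mul (dY x) ((dv1 x).fun_mul (dX x)), pd_mul (dv1 x) (dX x), hYi, ← hXi']
    ring
  have hyY : Y x = y := hy.symm
  have hXx : Real.exp (-β * Real.log (Real.exp (v x) + ε)) = X x := rfl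
  rw [hXx]
  constructor
  · rw [h1]
    simp only [hXi, hyY, hτ]
    field_simp
    ring
  · rw [h1, pd_add ((((ds x).fun_mul (ds1 x)).const_mul 2).fun_mul (dX x))
      ((ds x).fun_mul ((ds x).fun_mul (dX1 x))), pd_mul (((ds x).fun_mul (ds1 x)).const_mul 2) (dX x),
      pd_mul (differentiableAt_const _) ((ds x).fun_mul (ds1 x)), pd_const,
      pd_mul (ds x) (ds1 x), pd_mul (ds x) ((ds x).fun_mul (dX1 x)), pd_mul (ds x) (dX1 x), hXii]
    simp only [hXi, hyY, hτ]
    field_simp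
    ring

theorem bernstein_of_smooth {s v : E n → ℝ} (hs : ContDiff ℝ 2 s) (hv : ContDiff ℝ ∞ v)
    {β ε k d : ℝ} (hε : 0 < ε) {x : E n} (hsx : s x ≠ 0)
    (hmax : IsLocalMax (fun z => s z ^ 2 * Real.exp (-β * Real.log (Real.exp (v z) + ε)) *
      energy k d v z) x)
    {y : ℝ} (hy : y = Real.exp (v x) / (Real.exp (v x) + ε)) :
    (∀ i, ∑ l, 2 * pd l v x * pd i (pd l v) x + d * (k * Real.exp (k * v x) * pd i v x) =
      -(energy k d v x * (2 * (pd i s x / s x) - β * y * pd i v x))) ∧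
    2 * ∑ i, ∑ l, pd i (pd l v) x ^ 2 + 2 * ∑ l, pd l v x * pd l (sumPd v) x +
        d * (k * Real.exp (k * v x)) * (k * ∑ i, pd i v x ^ 2 + sumPd v x) +
      energy k d v x * ∑ i, (-(2 * (pd i s x / s x) - β * y * pd i v x) ^ 2
        - 2 * (pd i s x / s x) ^ 2 + 2 * (pd i (pd i s) x / s x)
        - β * (y * (1 - y)) * pd i v x ^ 2 - β * y * pd i (pd i v) x) ≤ 0 := by
  have hv2 : ContDiff ℝ 2 v := by exact_mod_cast contDiff_infty.1 hv 2
  have hS : ContDiff ℝ 2 (energy k d v) := contDiff_energy (contDiff_infty.1 hv 3) (by norm_num)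
  have hpos (z) : Real.exp (v z) + ε ≠ 0 := by positivity
  have hf : ContDiff ℝ 2 fun z => s z ^ 2 * Real.exp (-β * Real.log (Real.exp (v z) + ε)) :=
    (hs.pow 2).mul (contDiff_const.mul (((hv2.exp).add contDiff_const).log hpos)).exp
  have hfx : 0 < s x ^ 2 * Real.exp (-β * Real.log (Real.exp (v x) + ε)) := by positivity
  have key (i : Fin n) := by
    obtain ⟨h1, h2⟩ := pd_weight hs hv2 (β := β) hε hsx i hy rfl
    exact pd_of_mul_isLocalMax hf hS hmax hfx h1 h2
  refine ⟨fun i => by rw [← pd_energy hv2]; exact (key i).1, ?_⟩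
  rw [← sum_pd_pd_energy hv, Finset.mul_sum, ← Finset.sum_add_distrib]
  refine Finset.sum_nonpos fun i _ => le_of_eq_of_le ?_ (key i).2
  ring

end Bernstein

section Limit

variable {n : ℕ}

theorem sumPd_mollify (φ : ContDiffBump (0 : E n)) {W : E n → ℝ} (hW : ContDiff ℝ 2 W)
    (hc : HasCompactSupport W) :
    sumPd (φ.normed volume ⋆[lsmul ℝ ℝ, volume] W) =
      (φ.normed volume ⋆[lsmul ℝ ℝ, volume] sumPd W) := by
  have h1 (i : Fin n) : ContDiff ℝ 1 (pd i W) := hW.pd (by norm_num) i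
  have h2 (i : Fin n) : Continuous (pd i (pd i W)) :=
    ((h1 i).pd (m := 0) (by norm_num) i).continuous
  funext x
  have hpd (i : Fin n) : pd i (pd i (φ.normed volume ⋆[lsmul ℝ ℝ, volume] W)) x =
      (φ.normed volume ⋆[lsmul ℝ ℝ, volume] pd i (pd i W)) x := by
    rw [pd_convolution φ (hW.of_le (by norm_num)) hc, pd_convolution φ (h1 i) (hc.pd i)]
  have hint (i : Fin n) : Integrable
      (fun t => lsmul ℝ ℝ (φ.normed volume t) (pd i (pd i W) (x - t))) volume :=
    φ.hasCompactSupport_normed.convolutionExists_left _ φ.continuous_normed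
      (h2 i).locallyIntegrable x
  simp only [sumPd, hpd]
  simp only [convolution_def]
  rw [← integral_finsetSum _ fun i _ => hint i]
  simp only [sumPd, map_sum]

theorem exists_max_bernstein {s W g : E n → ℝ} (hs : ContDiff ℝ 2 s) (hW : ContDiff ℝ 2 W)
    (hWc : HasCompactSupport W) (hg : ContDiff ℝ 1 g) (hgc : HasCompactSupport g)
    {x₀ : E n} {ρ ρ' : ℝ} (hρ : 0 < ρ) (hρ' : ρ < ρ')
    (hWg : ∀ x ∈ ball x₀ ρ', sumPd W x = g x) (hs0 : ∀ x ∈ ball x₀ ρ, 0 < s x)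
    (hsb : ∀ x ∈ sphere x₀ ρ, s x = 0) (β k : ℝ) {ε d : ℝ} (hε : 0 < ε) (hd : 0 < d) :
    ∃ x ∈ ball x₀ ρ, (∀ z ∈ closedBall x₀ ρ,
        s z ^ 2 * Real.exp (-β * Real.log (Real.exp (W z) + ε)) * energy k d W z ≤
        s x ^ 2 * Real.exp (-β * Real.log (Real.exp (W x) + ε)) * energy k d W x) ∧
      ∀ y, y = Real.exp (W x) / (Real.exp (W x) + ε) →
      (∀ i, ∑ l, 2 * pd l W x * pd i (pd l W) x + d * (k * Real.exp (k * W x) * pd i W x) =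
        -(energy k d W x * (2 * (pd i s x / s x) - β * y * pd i W x))) ∧
      2 * ∑ i, ∑ l, pd i (pd l W) x ^ 2 + 2 * ∑ l, pd l W x * pd l g x +
          d * (k * Real.exp (k * W x)) * (k * ∑ i, pd i W x ^ 2 + g x) +
        energy k d W x * ∑ i, (-(2 * (pd i s x / s x) - β * y * pd i W x) ^ 2
          - 2 * (pd i s x / s x) ^ 2 + 2 * (pd i (pd i s) x / s x)
          - β * (y * (1 - y)) * pd i W x ^ 2 - β * y * pd i (pd i W) x) ≤ 0 := by
  set G : (E n → ℝ) → E n → ℝ := fun v z =>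
    s z ^ 2 * Real.exp (-β * Real.log (Real.exp (v z) + ε)) * energy k d v z with hG
  have hpos (v : E n → ℝ) (z) : 0 < Real.exp (v z) + ε := by positivity
  have hS0 (v : E n → ℝ) (z) : 0 < energy k d v z := by
    unfold energy
    have : 0 ≤ ∑ l, pd l v z ^ 2 := Finset.sum_nonneg fun _ _ => sq_nonneg _
    positivity
  have hW1 (l : Fin n) : ContDiff ℝ 1 (pd l W) := hW.pd (by norm_num) l
  have hW2 (i l : Fin n) : Continuous (pd i (pd l W)) :=
    ((hW1 l).pd (m := 0) (by norm_num) i).continuous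
  have hs1 (l : Fin n) : ContDiff ℝ 1 (pd l s) := hs.pd (by norm_num) l
  have hs2 (i l : Fin n) : Continuous (pd i (pd l s)) :=
    ((hs1 l).pd (m := 0) (by norm_num) i).continuous
  have hg1 (l : Fin n) : Continuous (pd l g) := (hg.pd (m := 0) (by norm_num) l).continuous
  let φ₀ : ℕ → ContDiffBump (0 : E n) := fun j =>
    ⟨1 / (2 * ((j : ℝ) + 1)), 1 / ((j : ℝ) + 1), by positivity, by
      apply one_div_lt_one_div_of_lt <;> nlinarith [Nat.cast_nonneg (α := ℝ) j]⟩
  have hφ₀ : Tendsto (fun j => (φ₀ j).rOut) atTop (𝓝 0) := tendsto_one_div_add_atTop_nhds_zero_nat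
  let v₀ : ℕ → E n → ℝ := fun j => ((φ₀ j).normed volume ⋆[lsmul ℝ ℝ, volume] W)
  have hv₀ (j) : ContDiff ℝ ∞ (v₀ j) := contDiff_mollify _ hW.continuous
  have hGc (j) : Continuous (G (v₀ j)) := by
    have h1 : Continuous (energy k d (v₀ j)) :=
      (contDiff_energy (m := 0) (contDiff_infty.1 (hv₀ j) 1) (by norm_num)).continuous
    have h2 : Continuous (v₀ j) := (hv₀ j).continuous
    exact ((hs.continuous.pow 2).mul (Real.continuous_exp.comp (continuous_const.mul
      (((Real.continuous_exp.comp h2).add continuous_const).log fun z => (hpos _ z).ne')))).mul h1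
  have hx (j) := (isCompact_closedBall x₀ ρ).exists_isMaxOn ⟨x₀, mem_closedBall_self hρ.le⟩
    (hGc j).continuousOn
  choose z₀ hz₀ hz₀m using hx
  obtain ⟨x, hxK, ψ, hψ, hψx⟩ := (isCompact_closedBall x₀ ρ).tendsto_subseq hz₀
  let φ : ℕ → ContDiffBump (0 : E n) := fun j => φ₀ (ψ j)
  have hφ : Tendsto (fun j => (φ j).rOut) atTop (𝓝 0) := hφ₀.comp hψ.tendsto_atTop
  let v : ℕ → E n → ℝ := fun j => ((φ j).normed volume ⋆[lsmul ℝ ℝ, volume] W)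
  have hv (j) : ContDiff ℝ ∞ (v j) := hv₀ _
  have hvp (j l) : pd l (v j) = ((φ j).normed volume ⋆[lsmul ℝ ℝ, volume] pd l W) :=
    pd_convolution _ (hW.of_le (by norm_num)) hWc l
  have hvpp (j i l) : pd i (pd l (v j)) =
      ((φ j).normed volume ⋆[lsmul ℝ ℝ, volume] pd i (pd l W)) := by
    rw [hvp, pd_convolution _ (hW1 l) (hWc.pd l) i]
  let z : ℕ → E n := fun j => z₀ (ψ j)
  have hz : Tendsto z atTop (𝓝 x) := hψx
  have tv {w : ℕ → E n} {a : E n} (hw : Tendsto w atTop (𝓝 a)) :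
      Tendsto (fun j => v j (w j)) atTop (𝓝 (W a)) := tendsto_mollify hφ hW.continuous hw
  have tp (l) {w : ℕ → E n} {a : E n} (hw : Tendsto w atTop (𝓝 a)) :
      Tendsto (fun j => pd l (v j) (w j)) atTop (𝓝 (pd l W a)) := by
    simp only [hvp]; exact tendsto_mollify hφ (hW1 l).continuous hw
  have tpp (i l) {w : ℕ → E n} {a : E n} (hw : Tendsto w atTop (𝓝 a)) :
      Tendsto (fun j => pd i (pd l (v j)) (w j)) atTop (𝓝 (pd i (pd l W) a)) := by
    simp only [hvpp]; exact tendsto_mollify hφ (hW2 i l) hw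
  have te {w : ℕ → E n} {a : E n} (hw : Tendsto w atTop (𝓝 a)) :
      Tendsto (fun j => Real.exp (v j (w j))) atTop (𝓝 (Real.exp (W a))) :=
    (Real.continuous_exp.tendsto _).comp (tv hw)
  have tek {w : ℕ → E n} {a : E n} (hw : Tendsto w atTop (𝓝 a)) :
      Tendsto (fun j => Real.exp (k * v j (w j))) atTop (𝓝 (Real.exp (k * W a))) :=
    (Real.continuous_exp.tendsto _).comp ((tv hw).const_mul k)
  have tS {w : ℕ → E n} {a : E n} (hw : Tendsto w atTop (𝓝 a)) :
      Tendsto (fun j => energy k d (v j) (w j)) atTop (𝓝 (energy k d W a)) :=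
    (tendsto_finsetSum _ fun l _ => (tp l hw).pow 2).add ((tek hw).const_mul d)
  have tG {w : ℕ → E n} {a : E n} (hw : Tendsto w atTop (𝓝 a)) :
      Tendsto (fun j => G (v j) (w j)) atTop (𝓝 (G W a)) :=
    ((((hs.continuous.tendsto a).comp hw).pow 2).mul ((Real.continuous_exp.tendsto _).comp
      ((((te hw).add_const ε).log (hpos W a).ne').const_mul (-β)))).mul (tS hw)
  have hmax (a) (ha : a ∈ closedBall x₀ ρ) : G W a ≤ G W x :=
    le_of_tendsto_of_tendsto (tG (tendsto_const_nhds (x := a))) (tG hz)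
      (Eventually.of_forall fun j => hz₀m (ψ j) ha)
  have hxb : x ∈ ball x₀ ρ := by
    by_contra hcon
    have h0 : s x = 0 := hsb x (le_antisymm hxK (not_lt.1 hcon))
    have h1 := hmax x₀ (mem_closedBall_self hρ.le)
    have h2 : 0 < G W x₀ := by
      have := hs0 x₀ (mem_ball_self hρ)
      have := hS0 W x₀
      simp only [hG]; positivity
    have h3 : G W x = 0 := by simp [hG, h0]
    linarith
  refine ⟨x, hxb, hmax, ?_⟩
  rintro y rfl
  have hsx := hs0 x hxb
  have hev1 : ∀ᶠ j in atTop, z j ∈ ball x₀ ρ := hz.eventually (isOpen_ball.mem_nhds hxb)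
  have hev2 : ∀ᶠ j in atTop, (φ j).rOut < ρ' - ρ :=
    hφ.eventually (gt_mem_nhds (by linarith))
  have hloc (j) (h1 : z j ∈ ball x₀ ρ) : IsLocalMax (G (v j)) (z j) := by
    filter_upwards [isOpen_ball.mem_nhds h1] with a ha
    exact hz₀m (ψ j) (ball_subset_closedBall ha)
  have hsum (j) (h1 : z j ∈ ball x₀ ρ) (h2 : (φ j).rOut < ρ' - ρ) :
      sumPd (v j) =ᶠ[𝓝 (z j)] ((φ j).normed volume ⋆[lsmul ℝ ℝ, volume] g) := by
    filter_upwards [isOpen_ball.mem_nhds h1] with a ha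
    rw [sumPd_mollify _ hW hWc]
    refine convolution_congr_ball _ fun b hb => hWg b ?_
    rw [mem_ball] at *
    linarith [dist_triangle b a x₀]
  have tg {w : ℕ → E n} {a : E n} (hw : Tendsto w atTop (𝓝 a)) :
      Tendsto (fun j => ((φ j).normed volume ⋆[lsmul ℝ ℝ, volume] g) (w j)) atTop (𝓝 (g a)) :=
    tendsto_mollify hφ hg.continuous hw
  have tgp (l) {w : ℕ → E n} {a : E n} (hw : Tendsto w atTop (𝓝 a)) :
      Tendsto (fun j => pd l ((φ j).normed volume ⋆[lsmul ℝ ℝ, volume] g) (w j)) atTop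
        (𝓝 (pd l g a)) := by
    simp only [pd_convolution _ hg hgc]
    exact tendsto_mollify hφ (hg1 l) hw
  have ts : Tendsto (fun j => s (z j)) atTop (𝓝 (s x)) := (hs.continuous.tendsto x).comp hz
  have tsp (i) : Tendsto (fun j => pd i s (z j) / s (z j)) atTop (𝓝 (pd i s x / s x)) :=
    (((hs1 i).continuous.tendsto x).comp hz).div ts hsx.ne'
  have tspp (i) : Tendsto (fun j => pd i (pd i s) (z j) / s (z j)) atTop
      (𝓝 (pd i (pd i s) x / s x)) :=
    (((hs2 i i).tendsto x).comp hz).div ts hsx.ne'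
  have ty := (te hz).div ((te hz).add_const ε) (hpos W x).ne'
  have hb (j) (h1 : z j ∈ ball x₀ ρ) :=
    bernstein_of_smooth hs (hv j) hε (hs0 _ h1).ne' (hloc j h1) rfl
  constructor
  · intro i
    refine tendsto_nhds_unique_of_eventuallyEq
      ((tendsto_finsetSum _ fun l _ => ((tp l hz).const_mul 2).mul (tpp i l hz)).add
        ((((tek hz).const_mul k).mul (tp i hz)).const_mul d))
      ((tS hz).mul (((tsp i).const_mul 2).sub ((ty.const_mul β).mul (tp i hz)))).neg ?_
    filter_upwards [hev1] with j h1
    exact (hb j h1).1 i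
  · refine le_of_tendsto
      ((((tendsto_finsetSum Finset.univ fun i _ => tendsto_finsetSum Finset.univ fun l _ =>
          (tpp i l hz).pow 2).const_mul 2).add
        ((tendsto_finsetSum Finset.univ fun l _ => (tp l hz).mul (tgp l hz)).const_mul 2)).add
        ((((tek hz).const_mul k).const_mul d).mul
          (((tendsto_finsetSum Finset.univ fun l _ => (tp l hz).pow 2).const_mul k).add (tg hz)))
        |>.add ((tS hz).mul (tendsto_finsetSum Finset.univ fun i _ =>
          ((((((((tsp i).const_mul 2).sub ((ty.const_mul β).mul (tp i hz))).pow 2).neg).sub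
            (((tsp i).pow 2).const_mul 2)).add ((tspp i).const_mul 2)).sub
            (((ty.mul (ty.const_sub 1)).const_mul β).mul ((tp i hz).pow 2))).sub
            ((ty.const_mul β).mul (tpp i i hz))))) ?_
    filter_upwards [hev1, hev2] with j h1 h2
    have := (hb j h1).2
    simp only [pd_congr (hsum j h1 h2), (hsum j h1 h2).eq_of_nhds] at this
    exact this

end Limit

section Algebra

theorem hessian_lower_bound {n : ℕ} (H : Fin n → Fin n → ℝ) (a : Fin n → ℝ) {N : ℝ} (hN : 0 < N)
    (hn : (n : ℝ) ≤ N) (z : ℝ) :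
    (∑ i, H i i - z * ∑ i, a i ^ 2) ^ 2 / N + 2 * z * ∑ i, ∑ l, a i * a l * H i l
      - z ^ 2 * (∑ i, a i ^ 2) ^ 2 ≤ ∑ i, ∑ l, H i l ^ 2 := by
  set p := ∑ i, a i ^ 2 with hp
  set x := (∑ i, H i i - z * p) / N with hx
  have h0 : 0 ≤ ∑ i, ∑ l, (H i l - z * (a i * a l) - if i = l then x else 0) ^ 2 :=
    Finset.sum_nonneg fun _ _ => Finset.sum_nonneg fun _ _ => sq_nonneg _
  have h1 (i l : Fin n) : (H i l - z * (a i * a l) - if i = l then x else 0) ^ 2 =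
      H i l ^ 2 - 2 * z * (a i * a l * H i l) + z ^ 2 * (a i ^ 2 * a l ^ 2) +
        if i = l then x ^ 2 - 2 * x * (H i l - z * (a i * a l)) else 0 := by
    split_ifs <;> ring
  have h2 : ∑ i, ∑ l, z ^ 2 * (a i ^ 2 * a l ^ 2) = z ^ 2 * p ^ 2 := by
    simp only [← Finset.mul_sum, ← Finset.sum_mul, ← hp, sq p]
  have h3 : ∑ i, (x ^ 2 - 2 * x * (H i i - z * (a i * a i))) =
      n * x ^ 2 - 2 * x * (∑ i, H i i - z * p) := by
    simp only [Finset.sum_sub_distrib, ← Finset.mul_sum, hp, sq (a _)]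
    simp
  simp only [h1, Finset.sum_add_distrib, Finset.sum_ite_eq, Finset.mem_univ, if_true, h2] at h0
  rw [h3] at h0
  simp only [Finset.sum_sub_distrib, ← Finset.mul_sum] at h0
  have h4 : ∑ i, H i i - z * p = N * x := by rw [hx]; field_simp
  rw [h4] at h0 ⊢
  have h5 : (N * x) ^ 2 / N = N * x ^ 2 := by field_simp
  rw [h5]
  nlinarith [mul_le_mul_of_nonneg_right hn (sq_nonneg x)]

/-- The coefficient of `pq` in the quadratic form governing the Bernstein argument, at `y = 1`. -/
noncomputable def mixedCoeff (N k β d : ℝ) : ℝ :=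
  (N * β * (d * (β - k)) + 2 * (β + d * (β - k)) + 4) / (N - 1) - d * (β - k) * (k + β + 1)
    - 2 * k + β

theorem quadratic_ge_sub {c₁ c₂ y : ℝ} (c₀ : ℝ) (hy0 : 0 ≤ y) (hy1 : y ≤ 1) :
    c₀ + c₁ + c₂ - (|c₁| + 2 * |c₂|) * (1 - y) ≤ c₀ + c₁ * y + c₂ * y ^ 2 := by
  have h1 := le_abs_self c₁
  have h2 : c₂ * (1 + y) ≤ |c₂| * 2 :=
    mul_le_mul (le_abs_self c₂) (by linarith) (by linarith) (abs_nonneg _)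
  nlinarith [mul_le_mul_of_nonneg_right (add_le_add h1 h2) (sub_nonneg.2 hy1)]

theorem bernstein_quadratic_form {N k d b b' z p q T h₂ t m L : ℝ} (hN : 1 < N)
    (hz : z = (N * b / 2 + 1) / (N - 1))
    (h1 : 2 * T + d * (k * q * p) = (p + d * q) * (b * p - t))
    (h2 : 2 * h₂ + 2 * (-(2 * T + k * q * p)) + d * (k * q) * (k * p - (p + q)) +
      (p + d * q) * (-(4 * m) + 2 * b * t - b ^ 2 * p - 2 * m + 2 * L - b' * p + b * (p + q)) ≤ 0)
    (hh : (-(p + q) - z * p) ^ 2 / N + 2 * z * T - z ^ 2 * p ^ 2 ≤ h₂) :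
    (-(N - 2) * b ^ 2 / 2 - (N - 3) * b + 2 - (N - 1) * b') / (N - 1) * p ^ 2 +
      ((N * b * (d * (b - k)) + 2 * (b + d * (b - k)) + 4) / (N - 1) - d * (b - k) * (k + b + 1)
        - 2 * k + b - d * b') * (p * q) + (2 / N + d * (b - k)) * q ^ 2 +
      (p + d * q) * (2 * (1 + b - z) * t - 6 * m + 2 * L) ≤ 0 := by
  have hT : T = ((p + d * q) * (b * p - t) - d * (k * q * p)) / 2 := by linarith
  subst hT
  have hN1 : N - 1 ≠ 0 := by linarith
  have hN0 : N ≠ 0 := by linarith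
  have key : (-(N - 2) * b ^ 2 / 2 - (N - 3) * b + 2 - (N - 1) * b') / (N - 1) * p ^ 2 +
      ((N * b * (d * (b - k)) + 2 * (b + d * (b - k)) + 4) / (N - 1) - d * (b - k) * (k + b + 1)
        - 2 * k + b - d * b') * (p * q) + (2 / N + d * (b - k)) * q ^ 2 +
      (p + d * q) * (2 * (1 + b - z) * t - 6 * m + 2 * L) =
      2 * ((-(p + q) - z * p) ^ 2 / N + 2 * z * (((p + d * q) * (b * p - t) - d * (k * q * p)) / 2)
        - z ^ 2 * p ^ 2) +
      2 * (-(2 * (((p + d * q) * (b * p - t) - d * (k * q * p)) / 2) + k * q * p)) +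
      d * (k * q) * (k * p - (p + q)) +
      (p + d * q) * (-(4 * m) + 2 * b * t - b ^ 2 * p - 2 * m + 2 * L - b' * p + b * (p + q)) := by
    subst hz
    field_simp
    ring
  rw [key]
  linarith

end Algebra

section Contradiction

theorem square_coeff_ge {N β y : ℝ} (hN : 2 < N) (hβ : 0 ≤ β) (hβN : (N - 2) * β ≤ 2)
    (hy1 : y ≤ 1) :
    2 * (1 - (N - 2) * β / 2) ^ 2 ≤ -(N - 2) * (β * y) ^ 2 / 2 - (N - 3) * (β * y) + 2 -
      (N - 1) * (β * (y * (1 - y))) := by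
  set x := (N - 2) * β / 2 with hx
  have hx0 : 0 ≤ x := by
    have : 0 ≤ N - 2 := by linarith
    positivity
  have hx1 : 0 ≤ 1 - x := by linarith
  have h1 : x * y ≤ x := mul_le_of_le_one_right hx0 hy1
  have h2 : (1 - x) ^ 2 ≤ (1 - x * y) ^ 2 := by gcongr
  have h3 : 0 ≤ (2 * x + β) * y ^ 2 * (1 - x) := by positivity
  have e : -(N - 2) * (β * y) ^ 2 / 2 - (N - 3) * (β * y) + 2 - (N - 1) * (β * (y * (1 - y))) =
      2 * (1 - x * y) ^ 2 + (2 * x + β) * y ^ 2 * (1 - x) := by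
    rw [hx]; ring
  linarith

theorem exists_bernstein_gap {N k β d : ℝ} (hN : 2 < N) (hd : 0 < d) (hβ : 0 ≤ β)
    (hβN : (N - 2) * β < 2) (hB : 0 < mixedCoeff N k β d) (hC : 0 < 2 / N + d * (β - k)) :
    ∃ η : ℝ, 0 < η ∧ ∀ y p q T h₂ t m L : ℝ, 0 ≤ y → y ≤ 1 → 0 ≤ p → 0 < q → 0 ≤ m →
      2 * T + d * (k * q * p) = (p + d * q) * (β * y * p - t) →
      2 * h₂ + 2 * (-(2 * T + k * q * p)) + d * (k * q) * (k * p - (p + q)) +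
        (p + d * q) * (-(4 * m) + 2 * (β * y) * t - (β * y) ^ 2 * p - 2 * m + 2 * L
          - β * (y * (1 - y)) * p + β * y * (p + q)) ≤ 0 →
      (∀ z, (-(p + q) - z * p) ^ 2 / N + 2 * z * T - z ^ 2 * p ^ 2 ≤ h₂) →
      t ^ 2 ≤ 4 * p * m → (1 - y) * q ≤ η * (p + d * q) → m ≤ η ^ 2 * (p + d * q) →
      -L ≤ η * (p + d * q) → False := by
  have hN1 : 0 < N - 1 := by linarith
  set A₀ := 2 * (1 - (N - 2) * β / 2) ^ 2 / (N - 1) with hA₀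
  set B₁ := mixedCoeff N k β d with hB₁
  set C₁ := 2 / N + d * (β - k) with hC₁
  have hA₀p : 0 < A₀ := by
    have : 0 < 1 - (N - 2) * β / 2 := by linarith
    positivity
  obtain ⟨c₀, c₁, c₂, hBq⟩ : ∃ c₀ c₁ c₂ : ℝ, ∀ y,
      (N * (β * y) * (d * (β * y - k)) + 2 * (β * y + d * (β * y - k)) + 4) / (N - 1)
        - d * (β * y - k) * (k + β * y + 1) - 2 * k + β * y - d * (β * (y * (1 - y))) =
      c₀ + c₁ * y + c₂ * y ^ 2 :=
    ⟨(-2 * d * k + 4) / (N - 1) + d * k * (k + 1) - 2 * k,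
      (-N * β * d * k + 2 * (β + d * β)) / (N - 1) - d * β + β - d * β,
      N * β ^ 2 * d / (N - 1) - d * β ^ 2 + d * β, fun y => by field_simp; ring⟩
  have hB1 : c₀ + c₁ + c₂ = B₁ := by
    have := hBq 1
    simp only [mul_one, one_pow, sub_self, mul_zero, sub_zero] at this
    rw [← this, hB₁, mixedCoeff]
  set M := |c₁| + 2 * |c₂| + d * β with hM
  have hM0 : 0 ≤ M := by positivity
  set c := min A₀ (min (B₁ / (2 * d)) (C₁ / d ^ 2)) with hc
  have hc0 : 0 < c := by
    simp only [hc, lt_min_iff]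
    exact ⟨hA₀p, by positivity, by positivity⟩
  have hcA : c ≤ A₀ := min_le_left _ _
  have hcB : 2 * d * c ≤ B₁ := by
    have : c ≤ B₁ / (2 * d) := (min_le_right _ _).trans (min_le_left _ _)
    rw [le_div_iff₀ (by positivity)] at this; linarith
  have hcC : d ^ 2 * c ≤ C₁ := by
    have : c ≤ C₁ / d ^ 2 := (min_le_right _ _).trans (min_le_right _ _)
    rw [le_div_iff₀ (by positivity)] at this; linarith
  set c' := 2 * (1 + β + (N * β / 2 + 1) / (N - 1)) with hc'
  have hc'0 : 0 ≤ c' := by positivity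
  set D := M * (1 + 1 / d) + 2 * c' + 8 with hD
  have hD0 : 0 < D := by positivity
  refine ⟨min 1 (c / (2 * D)), lt_min one_pos (by positivity), ?_⟩
  set η := min 1 (c / (2 * D)) with hη
  have hη0 : 0 < η := lt_min one_pos (by positivity)
  have hη1 : η ≤ 1 := min_le_left _ _
  have hηD : η * D < c := by
    have : η ≤ c / (2 * D) := min_le_right _ _
    rw [le_div_iff₀ (by positivity)] at this; linarith [mul_pos hη0 hD0]
  intro y p q T h₂ t m L hy0 hy1 hp hq hm h1 h2 hh ht hr hmS hL
  set S := p + d * q with hS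
  have hS0 : 0 < S := by positivity
  set z := (N * (β * y) / 2 + 1) / (N - 1) with hz
  have main := bernstein_quadratic_form (by linarith) hz h1 h2 (hh z)
  rw [hBq] at main
  have hb1 : β * y ≤ β := mul_le_of_le_one_right hβ hy1
  have hb0 : 0 ≤ β * y := by positivity
  have hz0 : 0 ≤ z := by positivity
  have hz1 : z ≤ (N * β / 2 + 1) / (N - 1) := by
    have : N * (β * y) ≤ N * β := mul_le_mul_of_nonneg_left hb1 (by linarith)
    exact div_le_div_of_nonneg_right (by linarith) hN1.le
  have hA : A₀ ≤ (-(N - 2) * (β * y) ^ 2 / 2 - (N - 3) * (β * y) + 2 -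
      (N - 1) * (β * (y * (1 - y)))) / (N - 1) := by
    exact div_le_div_of_nonneg_right (square_coeff_ge hN hβ hβN.le hy1) hN1.le
  have hBy := quadratic_ge_sub (c₁ := c₁) (c₂ := c₂) c₀ hy0 hy1
  rw [hB1] at hBy
  have hpq : p + q ≤ (1 + 1 / d) * S := by
    have : (1 + 1 / d) * S = p + d * q + p / d + q := by rw [hS]; field_simp; ring
    rw [this]
    have : 0 ≤ p / d + d * q := by positivity
    linarith only [this]
  have hquad : c * S ^ 2 ≤ A₀ * p ^ 2 + B₁ * (p * q) + C₁ * q ^ 2 := by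
    have e : c * S ^ 2 = c * p ^ 2 + 2 * d * c * (p * q) + d ^ 2 * c * q ^ 2 := by rw [hS]; ring
    rw [e]
    gcongr
  have hlow : A₀ * p ^ 2 + B₁ * (p * q) + C₁ * q ^ 2 - M * ((1 - y) * q * (p + q)) ≤
      (-(N - 2) * (β * y) ^ 2 / 2 - (N - 3) * (β * y) + 2 -
      (N - 1) * (β * (y * (1 - y)))) / (N - 1) * p ^ 2 +
      (c₀ + c₁ * y + c₂ * y ^ 2) * (p * q) + (2 / N + d * (β * y - k)) * q ^ 2 := by
    have i1 := mul_le_mul_of_nonneg_right hA (sq_nonneg p)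
    have i2 := mul_le_mul_of_nonneg_right hBy (mul_nonneg hp hq.le)
    have i3 : (2 / N + d * (β * y - k)) * q ^ 2 = C₁ * q ^ 2 - d * β * ((1 - y) * q ^ 2) := by
      rw [hC₁]; ring
    have hy : 0 ≤ 1 - y := sub_nonneg.2 hy1
    have i4 : 0 ≤ (|c₁| + 2 * |c₂|) * ((1 - y) * q ^ 2) := by positivity
    have i5 : 0 ≤ d * β * ((1 - y) * (q * p)) := by positivity
    rw [i3, hM]
    linarith only [i1, i2, i4, i5]
  have herr : (1 - y) * q * (p + q) ≤ η * S * ((1 + 1 / d) * S) := by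
    have : 0 ≤ 1 - y := sub_nonneg.2 hy1
    gcongr
  have habs : |t| ≤ 2 * η * S := by
    refine abs_le_of_sq_le_sq ?_ (by positivity)
    have hpS : p ≤ S := by rw [hS]; exact le_add_of_nonneg_right (mul_pos hd hq).le
    calc t ^ 2 ≤ 4 * p * m := ht
      _ ≤ 4 * S * (η ^ 2 * S) := by gcongr
      _ = _ := by ring
  have hcoef : |2 * (1 + β * y - z)| ≤ c' := by
    rw [abs_le, hc']
    constructor <;> linarith only [hb0, hb1, hz0, hz1, hβ]
  have hprod : -(c' * (2 * η * S)) ≤ 2 * (1 + β * y - z) * t := by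
    have := neg_abs_le (2 * (1 + β * y - z) * t)
    rw [abs_mul] at this
    have h3 : |2 * (1 + β * y - z)| * |t| ≤ c' * (2 * η * S) := by gcongr
    linarith only [this, h3]
  have hm' : m ≤ η * S := hmS.trans
    (mul_le_mul_of_nonneg_right (pow_le_of_le_one hη0.le hη1 two_ne_zero) hS0.le)
  have hE : -(η * S * (2 * c' + 8)) ≤ 2 * (1 + β * y - z) * t - 6 * m + 2 * L := by
    linarith only [hprod, hm', hL]
  have hE2 := mul_le_mul_of_nonneg_left hE hS0.le
  have hMerr := mul_le_mul_of_nonneg_left herr hM0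
  have : c * S ^ 2 ≤ η * D * S ^ 2 := by
    rw [hD]
    linarith only [main, hlow, hquad, hE2, hMerr]
  have := le_of_mul_le_mul_right this (by positivity)
  exact absurd this (not_le.2 hηD)

end Contradiction

section Parameters

theorem continuous_mixedCoeff (N k β : ℝ) : Continuous (mixedCoeff N k β) := by
  unfold mixedCoeff
  fun_prop

theorem exists_bernstein_params {N k : ℝ} (hN : 2 < N) (hk : k < 4 / (N - 2)) :
    ∃ β d : ℝ, 0 < d ∧ 0 ≤ β ∧ (N - 2) * β < 2 ∧ 0 < mixedCoeff N k β d ∧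
      0 < 2 / N + d * (β - k) ∧ (β < k ∨ β = 0 ∧ k ≤ 0) := by
  have hN2 : 0 < N - 2 := by linarith
  have hN1 : 0 < N - 1 := by linarith
  have hN0 : 0 < N := by linarith
  rw [lt_div_iff₀ hN2] at hk
  rcases le_or_gt k 0 with hk0 | hk0
  · have h0 : 0 < mixedCoeff N k 0 0 := by
      have : mixedCoeff N k 0 0 = 4 / (N - 1) - 2 * k := by unfold mixedCoeff; ring
      rw [this]
      have : 0 < 4 / (N - 1) := by positivity
      linarith
    have hev : ∀ᶠ d in 𝓝[>] (0 : ℝ), 0 < mixedCoeff N k 0 d :=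
      nhdsWithin_le_nhds (((continuous_mixedCoeff N k 0).tendsto 0).eventually (lt_mem_nhds h0))
    obtain ⟨d, hd, hd0⟩ := (hev.and self_mem_nhdsWithin).exists
    have hd0 : 0 < d := hd0
    refine ⟨0, d, hd0, le_rfl, by linarith, hd, ?_, Or.inr ⟨rfl, hk0⟩⟩
    have : 0 ≤ d * (0 - k) := mul_nonneg hd0.le (by linarith)
    positivity
  · obtain ⟨β, hβl, hβr⟩ : ∃ β, max 0 ((2 * k * (N - 1) - 6) / (N + 2)) < β ∧
        β < min k (2 / (N - 2)) := by
      apply exists_between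
      rw [max_lt_iff, lt_min_iff, lt_min_iff, div_lt_iff₀ (by linarith),
        div_lt_div_iff₀ (by linarith) hN2]
      refine ⟨⟨hk0, by positivity⟩, ?_, ?_⟩
      · nlinarith
      · nlinarith
    rw [max_lt_iff, div_lt_iff₀ (by linarith)] at hβl
    rw [lt_min_iff, lt_div_iff₀ hN2] at hβr
    have hkβ : 0 < k - β := by linarith
    have h0 : 0 < mixedCoeff N k β (2 / N / (k - β)) := by
      have : mixedCoeff N k β (2 / N / (k - β)) =
          (6 + β * (N + 2) - 2 * k * (N - 1)) / N := by
        have : 2 / N / (k - β) * (β - k) = -2 / N := by field_simp; ring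
        rw [mixedCoeff, this]
        field_simp
        ring
      rw [this]
      apply div_pos _ hN0
      linarith
    have hev : ∀ᶠ d in 𝓝[<] (2 / N / (k - β)), 0 < mixedCoeff N k β d :=
      nhdsWithin_le_nhds (((continuous_mixedCoeff N k β).tendsto _).eventually (lt_mem_nhds h0))
    have hev2 : ∀ᶠ d in 𝓝[<] (2 / N / (k - β)), 0 < d :=
      nhdsWithin_le_nhds (lt_mem_nhds (by positivity))
    obtain ⟨d, ⟨hd, hd0⟩, hd1⟩ := ((hev.and hev2).and self_mem_nhdsWithin).exists
    refine ⟨β, d, hd0, hβl.1.le, by linarith, hd, ?_, Or.inl hβr.1⟩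
    have : d * (k - β) < 2 / N := (lt_div_iff₀ hkβ).1 hd1
    linarith

theorem exists_dimension_bound (n : ℕ) (α : ℝ)
    (hα : 2 < n → α < ((n : ℝ) + 2) / ((n : ℝ) - 2)) :
    ∃ N : ℝ, 2 < N ∧ (n : ℝ) ≤ N ∧ α - 1 < 4 / (N - 2) := by
  rcases lt_or_ge 2 n with h | h
  · have hn2 : (2 : ℝ) < n := by exact_mod_cast h
    have h1 : (0 : ℝ) < n - 2 := by linarith
    refine ⟨n, hn2, le_rfl, ?_⟩
    have := hα h
    have e : ((n : ℝ) + 2) / (n - 2) = 4 / (n - 2) + 1 := by field_simp; ring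
    linarith
  · have hn2 : (n : ℝ) ≤ 2 := by exact_mod_cast h
    have h1 : 0 < 2 / (|α - 1| + 1) := by positivity
    refine ⟨2 + 2 / (|α - 1| + 1), by linarith, by linarith, ?_⟩
    have e : 4 / (2 + 2 / (|α - 1| + 1) - 2) = 2 * (|α - 1| + 1) := by
      rw [add_sub_cancel_left]
      field_simp
      norm_num
    rw [e]
    linarith [le_abs_self (α - 1), abs_nonneg (α - 1)]

end Parameters

section Cutoff

variable {n : ℕ}

theorem contDiff_cutoff (x₀ : E n) (r : ℝ) {m : WithTop ℕ∞} :
    ContDiff ℝ m fun z : E n => r ^ 2 - ‖z - x₀‖ ^ 2 :=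
  contDiff_const.sub ((contDiff_id.sub contDiff_const).norm_sq ℝ)

theorem pd_cutoff (x₀ : E n) (r : ℝ) (i : Fin n) :
    pd i (fun z : E n => r ^ 2 - ‖z - x₀‖ ^ 2) = fun z => -2 * (z i - x₀ i) := by
  funext z
  have h := ((hasFDerivAt_id (𝕜 := ℝ) z).sub_const x₀).norm_sq.const_sub (r ^ 2)
  rw [pd, show (fun z : E n => r ^ 2 - ‖z - x₀‖ ^ 2) = fun z => r ^ 2 - ‖id z - x₀‖ ^ 2 from rfl,
    h.fderiv]
  simp [EuclideanSpace.inner_single_right]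

theorem pd_pd_cutoff (x₀ : E n) (r : ℝ) (i : Fin n) (x : E n) :
    pd i (pd i fun z : E n => r ^ 2 - ‖z - x₀‖ ^ 2) x = -2 := by
  rw [pd_cutoff]
  have h : HasFDerivAt (fun z : E n => -2 * (z i - x₀ i))
      ((-2 : ℝ) • (EuclideanSpace.proj i : E n →L[ℝ] ℝ)) x :=
    (((EuclideanSpace.proj i : E n →L[ℝ] ℝ).hasFDerivAt).sub_const _).const_mul _
  rw [pd, h.fderiv]
  simp

end Cutoff

section MaxBound

variable {n : ℕ}

theorem contract_gradient_identity {a σ : Fin n → ℝ} {H : Fin n → Fin n → ℝ} {S b c d : ℝ}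
    (h : ∀ i, ∑ l, 2 * a l * H i l + d * (c * a i) = -(S * (2 * σ i - b * a i))) :
    2 * ∑ i, ∑ l, a i * a l * H i l + d * (c * ∑ i, a i ^ 2) =
      S * (b * ∑ i, a i ^ 2 - 2 * ∑ i, a i * σ i) := by
  have h1 := Finset.sum_congr rfl fun i (_ : i ∈ Finset.univ) => congrArg (a i * ·) (h i)
  have h2 (i : Fin n) : a i * (∑ l, 2 * a l * H i l + d * (c * a i)) =
      2 * ∑ l, a i * a l * H i l + d * (c * a i ^ 2) := by
    rw [mul_add, Finset.mul_sum, Finset.mul_sum]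
    congr 1
    · exact Finset.sum_congr rfl fun l _ => by ring
    · ring
  have h3 (i : Fin n) : a i * -(S * (2 * σ i - b * a i)) =
      S * (b * a i ^ 2 - 2 * (a i * σ i)) := by ring
  simp only [h2, h3, Finset.sum_add_distrib, ← Finset.mul_sum, Finset.sum_sub_distrib] at h1
  exact h1

theorem sum_weight_terms (a σ τ η : Fin n → ℝ) (b b' : ℝ) :
    ∑ i, (-(2 * σ i - b * a i) ^ 2 - 2 * σ i ^ 2 + 2 * τ i - b' * a i ^ 2 - b * η i) =
      -(4 * ∑ i, σ i ^ 2) + 2 * b * (2 * ∑ i, a i * σ i) - b ^ 2 * ∑ i, a i ^ 2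
        - 2 * ∑ i, σ i ^ 2 + 2 * ∑ i, τ i - b' * ∑ i, a i ^ 2 - b * ∑ i, η i := by
  simp only [Finset.mul_sum, ← Finset.sum_sub_distrib, ← Finset.sum_add_distrib,
    ← Finset.sum_neg_distrib]
  exact Finset.sum_congr rfl fun i _ => by ring

theorem sub_ratio_mul_rpow_le {k δ R ε U : ℝ} (hk : 0 < k) (hδ : 0 < δ) (hR : 0 < R) (hε : 0 < ε)
    (hεR : ε ^ k * R ^ 2 = 1) (hU : 0 < U) :
    (1 - U / (U + ε)) * U ^ k ≤ δ * U ^ k + δ⁻¹ ^ k / R ^ 2 := by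
  have e : 1 - U / (U + ε) = ε / (U + ε) := by field_simp; ring
  have hUk : 0 < U ^ k := by positivity
  rcases le_or_gt ε (δ * U) with h | h
  · have : 1 - U / (U + ε) ≤ δ := by
      rw [e, div_le_iff₀ (by positivity)]
      nlinarith
    have h2 : 0 ≤ δ⁻¹ ^ k / R ^ 2 := by positivity
    nlinarith [mul_le_mul_of_nonneg_right this hUk.le]
  · have h1 : 1 - U / (U + ε) ≤ 1 := by
      rw [e, div_le_one (by positivity)]; linarith
    have h2 : U ≤ δ⁻¹ * ε := by
      rw [inv_mul_eq_div, le_div_iff₀ hδ]; linarith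
    have h3 : U ^ k ≤ δ⁻¹ ^ k * ε ^ k := by
      rw [← Real.mul_rpow (by positivity) hε.le]
      exact Real.rpow_le_rpow hU.le h2 hk.le
    have h4 : ε ^ k = 1 / R ^ 2 := by field_simp; linarith
    rw [h4] at h3
    have h5 : 0 ≤ δ * U ^ k := by positivity
    calc _ ≤ 1 * U ^ k := by gcongr
      _ ≤ δ⁻¹ ^ k * (1 / R ^ 2) := by linarith
      _ ≤ _ := by rw [mul_one_div]; linarith

end MaxBound

section EnergyBound

variable {n : ℕ}

theorem energy_eq (k d : ℝ) (v : E n → ℝ) (x : E n) :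
    energy k d v x = ∑ l, pd l v x ^ 2 + d * Real.exp (k * v x) := rfl

theorem exists_max_bernstein_cutoff {k β d ε R : ℝ} (hd : 0 < d) (hR : 0 < R) (hε : 0 < ε)
    {x₀ : E n} {W : E n → ℝ} (hW : ContDiff ℝ 2 W) (hWc : HasCompactSupport W)
    (hWe : ∀ x ∈ ball x₀ (7 / 4 * R), sumPd W x = -energy k 1 W x) :
    ∃ x ∈ ball x₀ (3 / 2 * R), (∀ z ∈ closedBall x₀ (3 / 2 * R),
        ((3 / 2 * R) ^ 2 - ‖z - x₀‖ ^ 2) ^ 2 * Real.exp (-β * Real.log (Real.exp (W z) + ε)) *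
          energy k d W z ≤
        ((3 / 2 * R) ^ 2 - ‖x - x₀‖ ^ 2) ^ 2 * Real.exp (-β * Real.log (Real.exp (W x) + ε)) *
          energy k d W x) ∧
      ∃ T h₂ t : ℝ, ∀ y p q m s, y = Real.exp (W x) / (Real.exp (W x) + ε) →
        p = ∑ l, pd l W x ^ 2 → q = Real.exp (k * W x) →
        s = (3 / 2 * R) ^ 2 - ‖x - x₀‖ ^ 2 → m = 4 * ‖x - x₀‖ ^ 2 / s ^ 2 →
        2 * T + d * (k * q * p) = (p + d * q) * (β * y * p - t) ∧
        2 * h₂ + 2 * (-(2 * T + k * q * p)) + d * (k * q) * (k * p - (p + q)) +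
          (p + d * q) * (-(4 * m) + 2 * (β * y) * t - (β * y) ^ 2 * p - 2 * m +
          2 * (n * (-2 / s)) - β * (y * (1 - y)) * p + β * y * (p + q)) ≤ 0 ∧
        (∀ N : ℝ, 0 < N → n ≤ N → ∀ z, (-(p + q) - z * p) ^ 2 / N + 2 * z * T - z ^ 2 * p ^ 2 ≤ h₂) ∧
        t ^ 2 ≤ 4 * p * m := by
  let χ : ContDiffBump x₀ := ⟨7 / 4 * R, 2 * R, by positivity, by linarith⟩
  have hg : ContDiff ℝ 1 fun z => χ z * -energy k 1 W z :=
    χ.contDiff.mul (contDiff_energy hW (by norm_num)).neg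
  have hgc : HasCompactSupport fun z => χ z * -energy k 1 W z := χ.hasCompactSupport.mul_right
  have hχ (x) (hx : x ∈ ball x₀ (7 / 4 * R)) : χ x = 1 :=
    χ.one_of_mem_closedBall (ball_subset_closedBall hx)
  have hWg (x) (hx : x ∈ ball x₀ (7 / 4 * R)) : sumPd W x = χ x * -energy k 1 W x := by
    rw [hχ x hx, hWe x hx, one_mul]
  have hs0 (x) (hx : x ∈ ball x₀ (3 / 2 * R)) : 0 < (3 / 2 * R) ^ 2 - ‖x - x₀‖ ^ 2 := by
    rw [mem_ball_iff_norm] at hx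
    have := pow_lt_pow_left₀ hx (norm_nonneg _) two_ne_zero
    linarith
  have hsb (x) (hx : x ∈ sphere x₀ (3 / 2 * R)) : (3 / 2 * R) ^ 2 - ‖x - x₀‖ ^ 2 = 0 := by
    rw [mem_sphere_iff_norm] at hx
    rw [hx, sub_self]
  obtain ⟨x, hx, hmax, hid⟩ := exists_max_bernstein (contDiff_cutoff x₀ (3 / 2 * R)) hW hWc hg hgc
    (by positivity) (by linarith) hWg hs0 hsb β k hε hd
  refine ⟨x, hx, hmax, ∑ i, ∑ l, pd i W x * pd l W x * pd i (pd l W) x,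
    ∑ i, ∑ l, pd i (pd l W) x ^ 2, 2 * ∑ i, pd i W x * (-2 * (x i - x₀ i) /
      ((3 / 2 * R) ^ 2 - ‖x - x₀‖ ^ 2)), ?_⟩
  intro y p q m s hy hp hq hs hm
  have hx' : x ∈ ball x₀ (7 / 4 * R) := ball_subset_ball (by linarith) hx
  have hspos := hs0 x hx
  obtain ⟨h1, h2⟩ := hid y hy
  have hgx : (fun z => χ z * -energy k 1 W z) =ᶠ[𝓝 x] fun z => -energy k 1 W z := by
    filter_upwards [isOpen_ball.mem_nhds hx'] with z hz
    rw [hχ z hz, one_mul]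
  have hgp (l : Fin n) : pd l (fun z => χ z * -energy k 1 W z) x =
      -(∑ i, 2 * pd i W x * pd l (pd i W) x + k * q * pd l W x) := by
    rw [pd_congr hgx, pd_neg, pd_energy hW, hq, one_mul]
  have hagp : ∑ l, pd l W x * pd l (fun z => χ z * -energy k 1 W z) x =
      -(2 * ∑ i, ∑ l, pd i W x * pd l W x * pd i (pd l W) x + k * q * p) := by
    simp only [hgp, hp, Finset.mul_sum, ← Finset.sum_add_distrib, ← Finset.sum_neg_distrib]
    refine Finset.sum_congr rfl fun i _ => ?_
    rw [mul_neg, mul_add, Finset.mul_sum]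
    congr 2
    · exact Finset.sum_congr rfl fun l _ => by ring
    · ring
  have hSx : energy k d W x = p + d * q := by rw [energy_eq, hp, hq]
  have htr : ∑ i, pd i (pd i W) x = -(p + q) := by
    have := hWe x hx'
    rw [sumPd, energy_eq, one_mul, ← hp, ← hq] at this
    exact this
  have hgx0 : χ x * -energy k 1 W x = -(p + q) := by
    rw [← hWg x hx', sumPd, htr]
  have hσ : ∑ i, (-2 * (x i - x₀ i) / s) ^ 2 = m := by
    rw [hm, EuclideanSpace.norm_sq_eq, Finset.mul_sum, Finset.sum_div]
    refine Finset.sum_congr rfl fun i _ => ?_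
    rw [Real.norm_eq_abs, sq_abs, PiLp.sub_apply, div_pow]
    ring
  simp only [pd_pd_cutoff] at h2
  simp only [pd_cutoff] at h1 h2
  rw [← hs] at h1 h2 ⊢
  rw [hSx] at h1
  refine ⟨?_, ?_, ?_, ?_⟩
  · have := contract_gradient_identity h1
    rw [← hp, ← hq] at this
    exact this
  · rw [sum_weight_terms, hagp, hSx, htr, hgx0, hσ, ← hp, ← hq] at h2
    simp only [Finset.sum_const, Finset.card_univ, Fintype.card_fin, nsmul_eq_mul] at h2
    linarith
  · intro N hN hnN z
    have := hessian_lower_bound (fun i l => pd i (pd l W) x) (fun i => pd i W x) hN hnN z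
    rw [htr, ← hp] at this
    exact this
  · have := Finset.sum_mul_sq_le_sq_mul_sq Finset.univ (fun i => pd i W x)
      (fun i => -2 * (x i - x₀ i) / s)
    rw [hσ, ← hp] at this
    linarith

end EnergyBound

section UniformBound

variable {n : ℕ}

theorem exists_energy_bound {N k β d : ℝ} (hN : 2 < N) (hnN : n ≤ N) (hd : 0 < d) (hβ : 0 ≤ β)
    (hβN : (N - 2) * β < 2) (hB : 0 < mixedCoeff N k β d) (hC : 0 < 2 / N + d * (β - k))
    (hβk : β < k ∨ β = 0 ∧ k ≤ 0) :
    ∃ K : ℝ, 0 < K ∧ ∀ (x₀ : E n) (R ε : ℝ) (W : E n → ℝ), 0 < R → 0 < ε →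
      (0 < k → ε ^ k * R ^ 2 = 1) → ContDiff ℝ 2 W → HasCompactSupport W →
      (∀ x ∈ ball x₀ (7 / 4 * R), sumPd W x = -energy k 1 W x) →
      ∀ z ∈ ball x₀ R, energy k d W z ≤ K / R ^ 2 * ((Real.exp (W z) + ε) / ε) ^ β := by
  obtain ⟨η, hη, gap⟩ := exists_bernstein_gap hN hd hβ hβN hB hC
  set C := (η * d / 2)⁻¹ ^ k with hCdef
  have hC0 : 0 < C := by positivity
  set K := 4 / η ^ 2 + 2 * n / η + 9 * C / (2 * η) with hK
  have hK0 : 0 < K := by positivity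
  have hK1 : 4 ≤ η ^ 2 * K := by
    have : η ^ 2 * K = 4 + η ^ 2 * (2 * n / η + 9 * C / (2 * η)) := by rw [hK]; field_simp; ring
    rw [this]; exact le_add_of_nonneg_right (by positivity)
  have hK2 : 2 * n ≤ η * K := by
    have : η * K = 2 * n + η * (4 / η ^ 2 + 9 * C / (2 * η)) := by rw [hK]; field_simp; ring
    rw [this]; exact le_add_of_nonneg_right (by positivity)
  have hK3 : 9 / 4 * C ≤ η / 2 * K := by
    have : η / 2 * K = 9 / 4 * C + η / 2 * (4 / η ^ 2 + 2 * n / η) := by rw [hK]; field_simp; ring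
    rw [this]; exact le_add_of_nonneg_right (by positivity)
  refine ⟨2 * K, by positivity, ?_⟩
  intro x₀ R ε W hR hε hεR hW hWc hWe z hz
  obtain ⟨x, hx, hmax, T, h₂, t, hid⟩ :=
    exists_max_bernstein_cutoff (β := β) (k := k) hd hR hε hW hWc hWe
  set s := (3 / 2 * R) ^ 2 - ‖x - x₀‖ ^ 2 with hs
  set p := ∑ l, pd l W x ^ 2 with hp
  set q := Real.exp (k * W x) with hq
  have hp0 : 0 ≤ p := Finset.sum_nonneg fun _ _ => sq_nonneg _
  have hq0 : 0 < q := Real.exp_pos _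
  have hS : energy k d W x = p + d * q := rfl
  have hS0 : 0 < p + d * q := by positivity
  have hxR : ‖x - x₀‖ ^ 2 ≤ (3 / 2 * R) ^ 2 :=
    pow_le_pow_left₀ (norm_nonneg _) (mem_ball_iff_norm.1 hx).le 2
  have hs0 : 0 < s := by
    have := pow_lt_pow_left₀ (mem_ball_iff_norm.1 hx) (norm_nonneg _) two_ne_zero
    rw [hs]; linarith
  have hsρ : s ≤ (3 / 2 * R) ^ 2 := by rw [hs]; linarith [sq_nonneg ‖x - x₀‖]
  have hbound : s ^ 2 * (p + d * q) ≤ K * (3 / 2 * R) ^ 2 := by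
    by_contra! hcon
    have hρs : (3 / 2 * R) ^ 2 / s ^ 2 ≤ (p + d * q) / K := by
      rw [div_le_div_iff₀ (by positivity) hK0]; linarith
    have hRS : 1 / R ^ 2 ≤ 9 / 4 * ((p + d * q) / K) := by
      have h1 : K * (3 / 2 * R) ^ 2 ≤ ((3 / 2 * R) ^ 2) ^ 2 * (p + d * q) :=
        hcon.le.trans (by gcongr)
      have h2 : K ≤ 9 / 4 * R ^ 2 * (p + d * q) := by
        refine le_of_mul_le_mul_right ?_ (by positivity : 0 < (3 / 2 * R) ^ 2)
        linarith
      rw [mul_div_assoc', div_le_div_iff₀ (by positivity) hK0]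
      linarith
    have hm : 4 * ‖x - x₀‖ ^ 2 / s ^ 2 ≤ η ^ 2 * (p + d * q) :=
      calc 4 * ‖x - x₀‖ ^ 2 / s ^ 2 ≤ 4 * (3 / 2 * R) ^ 2 / s ^ 2 := by gcongr
        _ = 4 * ((3 / 2 * R) ^ 2 / s ^ 2) := by ring
        _ ≤ η ^ 2 * K * ((p + d * q) / K) := by gcongr
        _ = _ := by field_simp
    have hL : -(n * (-2 / s)) ≤ η * (p + d * q) :=
      calc -(n * (-2 / s)) = 2 * n * (s / s ^ 2) := by field_simp
        _ ≤ η * K * ((3 / 2 * R) ^ 2 / s ^ 2) := by gcongr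
        _ ≤ η * K * ((p + d * q) / K) := by gcongr
        _ = _ := by field_simp
    obtain ⟨i1, i2, i3, i4⟩ := hid _ p q _ s rfl rfl rfl rfl rfl
    have hNn := i3 N (by linarith) hnN
    have hm0 : 0 ≤ 4 * ‖x - x₀‖ ^ 2 / s ^ 2 := by positivity
    rcases hβk with hβk | ⟨hβ0, -⟩
    · have hk : 0 < k := hβ.trans_lt hβk
      have hU : 0 < Real.exp (W x) := Real.exp_pos _
      have hqU : q = Real.exp (W x) ^ k := by rw [hq, mul_comm, Real.exp_mul]
      have hratio := sub_ratio_mul_rpow_le hk (by positivity : 0 < η * d / 2) hR hε (hεR hk) hU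
      rw [← hqU, ← hCdef, ← mul_one_div C] at hratio
      refine gap _ p q T h₂ t _ _ (by positivity) ?_ hp0 hq0 hm0 i1 i2 hNn i4 (hratio.trans ?_) hm hL
      · rw [div_le_one (by positivity)]; linarith
      · have h1 : C * (1 / R ^ 2) ≤ η / 2 * (p + d * q) :=
          calc C * (1 / R ^ 2) ≤ C * (9 / 4 * ((p + d * q) / K)) := by gcongr
            _ = 9 / 4 * C * ((p + d * q) / K) := by ring
            _ ≤ η / 2 * K * ((p + d * q) / K) := by gcongr
            _ = _ := by field_simp
        have : 0 ≤ η * p := by positivity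
        linarith
    · subst hβ0
      simp only [zero_mul] at i1 i2
      refine gap 1 p q T h₂ t _ _ zero_le_one le_rfl hp0 hq0 hm0 ?_ ?_ hNn i4 ?_ hm hL
      · simpa only [zero_mul] using i1
      · simpa only [zero_mul] using i2
      · rw [sub_self, zero_mul]; positivity
  have hz' : z ∈ closedBall x₀ (3 / 2 * R) :=
    ball_subset_closedBall (ball_subset_ball (by linarith) hz)
  have h1 := hmax z hz'
  have hw (a : E n) :
      Real.exp (-β * Real.log (Real.exp (W a) + ε)) = (Real.exp (W a) + ε) ^ (-β) := by
    rw [Real.rpow_def_of_pos (by positivity), mul_comm]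
  rw [hw, hw, hS] at h1
  have hwz : 0 < Real.exp (W z) + ε := by positivity
  have hwx : (Real.exp (W x) + ε) ^ (-β) ≤ ε ^ (-β) :=
    Real.rpow_le_rpow_of_nonpos hε (by linarith [Real.exp_pos (W x)]) (by linarith)
  have hsz : 5 / 4 * R ^ 2 ≤ (3 / 2 * R) ^ 2 - ‖z - x₀‖ ^ 2 := by
    have := pow_le_pow_left₀ (norm_nonneg _) (mem_ball_iff_norm.1 hz).le 2
    linarith
  have hSz : 0 ≤ energy k d W z := by
    have : 0 ≤ ∑ l, pd l W z ^ 2 := Finset.sum_nonneg fun _ _ => sq_nonneg _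
    rw [energy_eq]; positivity
  have h2 : (5 / 4 * R ^ 2) ^ 2 * (Real.exp (W z) + ε) ^ (-β) * energy k d W z ≤
      ε ^ (-β) * (K * (3 / 2 * R) ^ 2) :=
    calc _ ≤ ((3 / 2 * R) ^ 2 - ‖z - x₀‖ ^ 2) ^ 2 * (Real.exp (W z) + ε) ^ (-β) *
          energy k d W z := by gcongr
      _ ≤ _ := h1
      _ = (Real.exp (W x) + ε) ^ (-β) * (s ^ 2 * (p + d * q)) := by ring
      _ ≤ _ := by gcongr
  rw [Real.rpow_neg hwz.le, Real.rpow_neg hε.le] at h2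
  rw [Real.div_rpow hwz.le hε.le]
  have hA : 0 < (Real.exp (W z) + ε) ^ β := by positivity
  have hE : 0 < ε ^ β := by positivity
  set A := (Real.exp (W z) + ε) ^ β with hAdef
  set e := ε ^ β with hedef
  have h3 : 25 / 16 * R ^ 2 * (energy k d W z * e) ≤ 9 / 4 * K * A := by
    have h4 := mul_le_mul_of_nonneg_right h2 (by positivity : 0 ≤ A * e / R ^ 2)
    have e1 : (5 / 4 * R ^ 2) ^ 2 * A⁻¹ * energy k d W z * (A * e / R ^ 2) =
      25 / 16 * R ^ 2 * (energy k d W z * e) := by field_simp; ring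
    have e2 : e⁻¹ * (K * (3 / 2 * R) ^ 2) * (A * e / R ^ 2) = 9 / 4 * K * A := by field_simp; ring
    rwa [e1, e2] at h4
  rw [div_mul_div_comm, le_div_iff₀ (by positivity)]
  have : 0 ≤ K * A := by positivity
  linarith

end UniformBound

section Assembly

variable {n : ℕ}

theorem exists_bound_of_mul_rpow_le {k β d K : ℝ} (hd : 0 < d) (hK : 0 < K) (hβ : 0 ≤ β)
    (hβk : β < k) :
    ∃ Z : ℝ, 0 < Z ∧ ∀ ζ : ℝ, 0 < ζ → d * ζ ^ k ≤ K * (1 + ζ) ^ β → ζ ≤ Z := by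
  have hkβ : 0 < k - β := sub_pos.2 hβk
  refine ⟨max 1 ((K * 2 ^ β / d) ^ (k - β)⁻¹), by positivity, fun ζ hζ h => ?_⟩
  rcases le_or_gt ζ 1 with h1 | h1
  · exact h1.trans (le_max_left _ _)
  · refine le_trans ?_ (le_max_right _ _)
    have h2 : (1 + ζ) ^ β ≤ 2 ^ β * ζ ^ β := by
      rw [← Real.mul_rpow (by norm_num) hζ.le]
      exact Real.rpow_le_rpow (by positivity) (by linarith) hβ
    have h3 : ζ ^ (k - β) ≤ K * 2 ^ β / d := by
      rw [Real.rpow_sub hζ, div_le_div_iff₀ (by positivity) hd]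
      calc ζ ^ k * d = d * ζ ^ k := mul_comm _ _
        _ ≤ K * (2 ^ β * ζ ^ β) := h.trans (by gcongr)
        _ = _ := by ring
    rwa [Real.le_rpow_inv_iff_of_pos hζ.le (by positivity) hkβ]

theorem exists_universal_energy_bound {N k β d : ℝ} (hN : 2 < N) (hnN : n ≤ N) (hd : 0 < d)
    (hβ : 0 ≤ β) (hβN : (N - 2) * β < 2) (hB : 0 < mixedCoeff N k β d)
    (hC : 0 < 2 / N + d * (β - k)) (hβk : β < k ∨ β = 0 ∧ k ≤ 0) :
    ∃ C : ℝ, 0 < C ∧ ∀ (x₀ : E n) (R : ℝ) (W : E n → ℝ), 0 < R → ContDiff ℝ 2 W →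
      HasCompactSupport W → (∀ x ∈ ball x₀ (7 / 4 * R), sumPd W x = -energy k 1 W x) →
      ∀ z ∈ ball x₀ R, energy k d W z ≤ C / R ^ 2 := by
  obtain ⟨K, hK, hbound⟩ := exists_energy_bound hN hnN hd hβ hβN hB hC hβk
  rcases hβk with hβk | ⟨rfl, hk⟩
  · have hk : 0 < k := hβ.trans_lt hβk
    obtain ⟨Z, hZ, hZb⟩ := exists_bound_of_mul_rpow_le hd hK hβ hβk
    refine ⟨K * (1 + Z) ^ β, by positivity, fun x₀ R W hR hW hWc hWe z hz => ?_⟩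
    set ε := (R ^ 2)⁻¹ ^ k⁻¹ with hε
    have hε0 : 0 < ε := by positivity
    have hεk : ε ^ k = (R ^ 2)⁻¹ := Real.rpow_inv_rpow (by positivity) hk.ne'
    have h1 := hbound x₀ R ε W hR hε0 (fun _ => by rw [hεk]; field_simp) hW hWc hWe z hz
    set ζ := Real.exp (W z) / ε with hζ
    have hζ0 : 0 < ζ := by positivity
    have e1 : (Real.exp (W z) + ε) / ε = 1 + ζ := by rw [hζ]; field_simp; ring
    have e2 : Real.exp (k * W z) = ζ ^ k / R ^ 2 := by
      rw [hζ, Real.div_rpow (Real.exp_pos _).le hε0.le, hεk, mul_comm, Real.exp_mul]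
      field_simp
    rw [e1] at h1
    have h2 : d * ζ ^ k ≤ K * (1 + ζ) ^ β := by
      have h3 : d * Real.exp (k * W z) ≤ energy k d W z :=
        le_add_of_nonneg_left (Finset.sum_nonneg fun _ _ => sq_nonneg _)
      have h4 := h3.trans h1
      rw [e2, mul_div_assoc', div_mul_eq_mul_div] at h4
      exact (div_le_div_iff_of_pos_right (by positivity)).1 h4
    have h5 := hZb ζ hζ0 h2
    calc energy k d W z ≤ K / R ^ 2 * (1 + ζ) ^ β := h1
      _ ≤ K / R ^ 2 * (1 + Z) ^ β := by gcongr
      _ = _ := by ring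
  · refine ⟨K, hK, fun x₀ R W hR hW hWc hWe z hz => ?_⟩
    have h1 := hbound x₀ R 1 W hR one_pos (fun h => absurd hk (not_le.2 h)) hW hWc hWe z hz
    rwa [Real.rpow_zero, mul_one] at h1

theorem pd_eq_of_eventuallyEq_exp {u W : E n → ℝ} {x : E n} (hW : ContDiff ℝ 2 W)
    (h : u =ᶠ[𝓝 x] fun z => Real.exp (W z)) (i : Fin n) :
    pd i u x = u x * pd i W x := by
  rw [pd_congr h, pd_comp (Real.hasDerivAt_exp _) (hW.differentiable (by norm_num) x),
    h.eq_of_nhds]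

theorem lap_eq_of_eventuallyEq_exp {u W : E n → ℝ} {x : E n} (hW : ContDiff ℝ 2 W)
    (h : u =ᶠ[𝓝 x] fun z => Real.exp (W z)) :
    lap u x = u x * (∑ i, pd i W x ^ 2 + sumPd W x) := by
  have hd : DifferentiableAt ℝ W x := hW.differentiable (by norm_num) x
  have hu : ContDiffAt ℝ 2 u x := hW.exp.contDiffAt.congr_of_eventuallyEq h
  rw [lap_eq_sum_pd hu, sumPd, ← Finset.sum_add_distrib, Finset.mul_sum]
  refine Finset.sum_congr rfl fun i _ => ?_
  have h1 : pd i u =ᶠ[𝓝 x] fun z => u z * pd i W z :=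
    h.eventuallyEq_nhds.mono fun _ hz => pd_eq_of_eventuallyEq_exp hW hz i
  rw [pd_congr h1, pd_mul (hu.differentiableAt (by norm_num))
    ((hW.pd (m := 1) (by norm_num) i).differentiable (by norm_num) x),
    pd_eq_of_eventuallyEq_exp hW h]
  ring

theorem exists_log_extension {x₀ : E n} {R : ℝ} (hR : 0 < R) {u : E n → ℝ}
    (hu : ContDiffOn ℝ 2 u (ball x₀ (2 * R))) (hpos : ∀ x ∈ ball x₀ (2 * R), 0 < u x) :
    ∃ W : E n → ℝ, ContDiff ℝ 2 W ∧ HasCompactSupport W ∧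
      ∀ x ∈ ball x₀ (7 / 4 * R), u =ᶠ[𝓝 x] fun z => Real.exp (W z) := by
  let χ : ContDiffBump x₀ := ⟨7 / 4 * R, 15 / 8 * R, by positivity, by linarith⟩
  refine ⟨fun z => χ z * Real.log (u z), ?_, χ.hasCompactSupport.mul_right, fun x hx => ?_⟩
  · refine contDiff_iff_contDiffAt.2 fun x => ?_
    by_cases hx : x ∈ tsupport χ
    · have hx2 : x ∈ ball x₀ (2 * R) := by
        rw [χ.tsupport_eq] at hx
        exact closedBall_subset_ball (by change 15 / 8 * R < 2 * R; linarith) hx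
      exact χ.contDiffAt.mul ((hu.contDiffAt (isOpen_ball.mem_nhds hx2)).log (hpos x hx2).ne')
    · refine (contDiffAt_const (c := (0 : ℝ))).congr_of_eventuallyEq ?_
      filter_upwards [notMem_tsupport_iff_eventuallyEq.1 hx] with z hz
      rw [hz, Pi.zero_apply, zero_mul]
  · filter_upwards [isOpen_ball.mem_nhds hx] with z hz
    rw [χ.one_of_mem_closedBall (ball_subset_closedBall hz), one_mul,
      Real.exp_log (hpos z (ball_subset_ball (by linarith) hz))]

end Assembly

/-- gradient and universal boundedness estimate for the Lane–Emden equation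
`Δu + u^α = 0` with `α < p_S(n)`. -/
theorem stmt4 (n : ℕ) (hn : 0 < n) (α : ℝ)
    (hαp : 2 < n → α < ((n : ℝ) + 2) / ((n : ℝ) - 2)) :
    ∃ C : ℝ, 0 < C ∧
      ∀ (x₀ : E n) (R : ℝ), 0 < R →
        ∀ u : E n → ℝ, ContDiffOn ℝ 2 u (ball x₀ (2 * R)) →
          (∀ x ∈ ball x₀ (2 * R), 0 < u x) →
          (∀ x ∈ ball x₀ (2 * R), lap u x + u x ^ α = 0) →
          ∀ x ∈ ball x₀ R,
            ‖gradient u x‖ ^ 2 / (u x) ^ 2 + u x ^ (α - 1) ≤ C / R ^ 2 := by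
  obtain ⟨N, hN, hnN, hk⟩ := exists_dimension_bound n α hαp
  obtain ⟨β, d, hd, hβ, hβN, hB, hC, hβk⟩ := exists_bernstein_params hN hk
  obtain ⟨C, hC0, hbound⟩ := exists_universal_energy_bound hN hnN hd hβ hβN hB hC hβk
  refine ⟨(1 + 1 / d) * C, by positivity, fun x₀ R hR u hu hpos heq x hx => ?_⟩
  obtain ⟨W, hW, hWc, hWu⟩ := exists_log_extension hR hu hpos
  have hpow {z : E n} (hz : z ∈ ball x₀ (7 / 4 * R)) :
      u z ^ (α - 1) = Real.exp ((α - 1) * W z) := by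
    rw [(hWu z hz).eq_of_nhds, mul_comm, Real.exp_mul]
  have hWe (z) (hz : z ∈ ball x₀ (7 / 4 * R)) : sumPd W z = -energy (α - 1) 1 W z := by
    have hz2 : z ∈ ball x₀ (2 * R) := ball_subset_ball (by linarith) hz
    have hp := hpos z hz2
    have h := heq z hz2
    have hmul : u z ^ α = u z * u z ^ (α - 1) := by
      rw [Real.rpow_sub_one hp.ne']; field_simp
    rw [lap_eq_of_eventuallyEq_exp hW (hWu z hz), hmul, ← mul_add, hpow hz] at h
    rw [energy_eq, one_mul]
    linarith [(mul_eq_zero.1 h).resolve_left hp.ne']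
  have h := hbound x₀ R W hR hW hWc hWe x hx
  have hx' : x ∈ ball x₀ (7 / 4 * R) := ball_subset_ball (by linarith) hx
  have hp := hpos x (ball_subset_ball (by linarith) hx)
  have hgrad : ‖gradient u x‖ ^ 2 / u x ^ 2 = ∑ i, pd i W x ^ 2 := by
    simp only [norm_gradient_sq, pd_eq_of_eventuallyEq_exp hW (hWu x hx'), mul_pow,
      ← Finset.mul_sum]
    field_simp
  rw [hgrad, hpow hx', mul_div_assoc]
  refine le_trans ?_ (mul_le_mul_of_nonneg_left h (by positivity))
  have hP : 0 ≤ ∑ i, pd i W x ^ 2 := Finset.sum_nonneg fun _ _ => sq_nonneg _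
  have hQ := Real.exp_pos ((α - 1) * W x)
  rw [energy_eq]
  set P := ∑ i, pd i W x ^ 2
  set Q := Real.exp ((α - 1) * W x)
  have e : (1 + 1 / d) * (P + d * Q) = P + Q + (P / d + d * Q) := by field_simp; ring
  rw [e]
  exact le_add_of_nonneg_right (by positivity)
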